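/- Assume N ≥ 2. Suppose δ ≥ 1 is an integer such that ord_0(f_h) ≤ δ for every h ∈ GL_{N+1}(k), and that for every h ∈ GL_{N+1}(k) with ord_0(f_h) = δ, the lowest-degree homogeneous part in_δ(f_h) is not a scalar multiple of x_0^δ (this quantified condition expresses that for every point P ∈ H(k) where H has multiplicity δ, the support of the projective tangent cone P(C_P H) ⊂ P^{N−1}_k is not a projective hyperplane). If d ≥ (N+1)·(δ−1), then for every g ∈ GL_{N+1}(k) and every nonzero α ∈ ℤ^{N+1} with Σ_{i=0}^N α_i = 0, one has deg_α(F∘g) ≥ 0; that is, F satisfies the Hilbert–Mumford criterion for semistability, so H is semistable. -/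

import Mathlib

open MvPolynomial

/-- The `α`-degree of a multivariate polynomial `G`: the maximum of `∑ i, m i * α i`
over the monomials `X^m` occurring in `G` with nonzero coefficient (0 if `G = 0`). -/
noncomputable def adeg {k : Type*} [CommSemiring k] {n : ℕ} (α : Fin n → ℤ)
    (G : MvPolynomial (Fin n) k) : ℤ :=
  if h : G.support.Nonempty then G.support.sup' h (fun m => ∑ i, (m i : ℤ) * α i) else 0

/-- `F ∘ g`: the polynomial obtained from `F` by the substitution `X i ↦ ∑ j, g i j • X j`. -/
noncomputable def substGL {k : Type*} [CommRing k] {n : ℕ}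
    (g : Matrix (Fin n) (Fin n) k) (F : MvPolynomial (Fin n) k) :
    MvPolynomial (Fin n) k :=
  aeval (fun i => ∑ j, C (g i j) * X j) F

/-- Dehomogenization with respect to the last variable:
`G(X_0, …, X_N) ↦ G(x_0, …, x_{N-1}, 1)`. -/
noncomputable def dehom {k : Type*} [CommRing k] {N : ℕ}
    (G : MvPolynomial (Fin (N+1)) k) : MvPolynomial (Fin N) k :=
  aeval (fun i : Fin (N+1) => if h : (i : ℕ) < N then X ⟨i, h⟩ else 1) G

/-- `ord_0 f`: the minimal total degree of a monomial occurring in `f`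
with nonzero coefficient (0 if `f = 0`). -/
noncomputable def ord0 {k : Type*} [CommSemiring k] {N : ℕ}
    (f : MvPolynomial (Fin N) k) : ℕ :=
  if h : f.support.Nonempty then f.support.inf' h (fun m => ∑ i, m i) else 0

/-- The ideal generated by `F` and its partial derivatives, defining the singular
locus `H_sing` of the hypersurface `H = {F = 0}`. -/
noncomputable def jacobianIdeal {k : Type*} [CommRing k] {N : ℕ}
    (F : MvPolynomial (Fin (N+1)) k) : Ideal (MvPolynomial (Fin (N+1)) k) :=
  Ideal.span ({F} ∪ Set.range (fun i => pderiv i F))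

section Substitution

variable {k : Type*} [CommRing k] {n N : ℕ}

theorem substGL_substGL (A g : Matrix (Fin n) (Fin n) k) (F : MvPolynomial (Fin n) k) :
    substGL A (substGL g F) = substGL (g * A) F := by
  unfold substGL
  rw [← AlgHom.comp_apply]
  congr 1
  refine MvPolynomial.algHom_ext fun i => ?_
  simp only [AlgHom.comp_apply, aeval_X, map_sum, map_mul, algHom_C, algebraMap_eq,
    Matrix.mul_apply, Finset.sum_mul, Finset.mul_sum]
  rw [Finset.sum_comm]
  simp only [mul_assoc]

theorem substGL_one (F : MvPolynomial (Fin n) k) : substGL 1 F = F := by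
  unfold substGL
  simp [Matrix.one_apply]

theorem substGL_ne_zero (g : Matrix.GeneralLinearGroup (Fin n) k) {F : MvPolynomial (Fin n) k}
    (hF : F ≠ 0) : substGL (↑g) F ≠ 0 := by
  intro h
  apply hF
  have := substGL_substGL (↑g⁻¹ : Matrix (Fin n) (Fin n) k) ↑g F
  rw [h, ← Units.val_mul, mul_inv_cancel, Units.val_one, substGL_one] at this
  rw [← this]
  simp [substGL]

theorem MvPolynomial.IsHomogeneous.substGL {d : ℕ} {F : MvPolynomial (Fin n) k}
    (hF : F.IsHomogeneous d) (g : Matrix (Fin n) (Fin n) k) :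
    (_root_.substGL g F).IsHomogeneous d := by
  have := hF.aeval (R := k) (fun i => ∑ j, C (g i j) * X j) (n := 1) fun i =>
    MvPolynomial.IsHomogeneous.sum _ _ _ fun j _ => (isHomogeneous_X k j).C_mul _
  simpa [_root_.substGL] using this

theorem homogeneousComponent_substGL (g : Matrix (Fin n) (Fin n) k)
    (f : MvPolynomial (Fin n) k) (e : ℕ) :
    homogeneousComponent e (substGL g f) = substGL g (homogeneousComponent e f) := by
  have key : ∀ i, homogeneousComponent e (substGL g (homogeneousComponent i f)) =
      if e = i then substGL g (homogeneousComponent i f) else 0 := fun i =>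
    homogeneousComponent_of_mem ((homogeneousComponent_isHomogeneous i f).substGL g)
  have hsum : substGL g f =
      ∑ i ∈ Finset.range (f.totalDegree + 1), substGL g (homogeneousComponent i f) := by
    conv_lhs => rw [← sum_homogeneousComponent f]
    simp [substGL]
  rw [hsum, map_sum, Finset.sum_congr rfl fun i _ => key i, Finset.sum_ite_eq]
  split_ifs with h
  · rfl
  · rw [homogeneousComponent_eq_zero e f (by simpa using h)]
    simp [substGL]

theorem substGL_permMatrix (σ : Equiv.Perm (Fin n)) (F : MvPolynomial (Fin n) k) :
    substGL (σ.permMatrix k) F = rename σ F := by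
  unfold substGL
  rw [rename_eq_aeval]
  congr 2
  funext i
  simp [Equiv.Perm.permMatrix, PEquiv.toMatrix_apply, Equiv.toPEquiv_apply]

end Substitution

section Dehomogenization

variable {k : Type*} [CommRing k] {N : ℕ}

/-- Forgetting the exponent of the last variable. -/
noncomputable def initExponent (M : Fin (N + 1) →₀ ℕ) : Fin N →₀ ℕ :=
  Finsupp.equivFunOnFinite.symm fun i => M i.castSucc

@[simp]
theorem initExponent_apply (M : Fin (N + 1) →₀ ℕ) (i : Fin N) :
    initExponent M i = M i.castSucc := rfl

theorem dehom_monomial (M : Fin (N + 1) →₀ ℕ) (c : k) :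
    dehom (monomial M c) = monomial (initExponent M) c := by
  rw [monomial_eq (s := initExponent M), dehom, aeval_monomial,
    Finsupp.prod_fintype _ _ (by simp), Finsupp.prod_fintype _ _ (by simp),
    Fin.prod_univ_castSucc]
  simp [algebraMap_eq]

theorem dehom_eq_sum (G : MvPolynomial (Fin (N + 1)) k) :
    dehom G = ∑ M ∈ G.support, monomial (initExponent M) (coeff M G) := by
  simp_rw [← dehom_monomial]
  unfold dehom
  rw [← map_sum, ← G.as_sum]

theorem exists_mem_support_of_mem_support_dehom {G : MvPolynomial (Fin (N + 1)) k}
    {m : Fin N →₀ ℕ} (hm : m ∈ (dehom G).support) :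
    ∃ M ∈ G.support, initExponent M = m := by
  classical
  by_contra! h
  rw [mem_support_iff, dehom_eq_sum, coeff_sum] at hm
  exact hm (Finset.sum_eq_zero fun M hM => by rw [coeff_monomial, if_neg (h M hM)])

theorem MvPolynomial.IsHomogeneous.sum_eq_of_mem_support {n d : ℕ}
    {G : MvPolynomial (Fin n) k} (hG : G.IsHomogeneous d) {M : Fin n →₀ ℕ}
    (hM : M ∈ G.support) : ∑ i, M i = d := by
  rw [← Finsupp.degree_eq_sum, Finsupp.degree_eq_weight_one]
  exact hG (mem_support_iff.mp hM)

theorem dehom_ne_zero {d : ℕ} {G : MvPolynomial (Fin (N + 1)) k} (hG : G.IsHomogeneous d)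
    (hG0 : G ≠ 0) : dehom G ≠ 0 := by
  classical
  obtain ⟨M, hM⟩ := support_nonempty.mpr hG0
  intro h
  have hc : coeff (initExponent M) (dehom G) = coeff M G := by
    rw [dehom_eq_sum, coeff_sum, Finset.sum_eq_single_of_mem M hM, coeff_monomial, if_pos rfl]
    intro M' hM' hne
    rw [coeff_monomial, if_neg]
    refine fun heq => hne (Finsupp.ext fun i => ?_)
    have hi : ∀ j : Fin N, M' j.castSucc = M j.castSucc := fun j => DFunLike.congr_fun heq j
    have h1 := hG.sum_eq_of_mem_support hM
    have h2 := hG.sum_eq_of_mem_support hM'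
    rw [Fin.sum_univ_castSucc] at h1 h2
    simp only [hi] at h2
    refine Fin.lastCases ?_ hi i
    omega
  rw [h, coeff_zero] at hc
  exact mem_support_iff.mp hM hc.symm

/-- The block matrix acting by `B` on the first `N` coordinates and fixing the last one. -/
def extendMatrix (B : Matrix (Fin N) (Fin N) k) : Matrix (Fin (N + 1)) (Fin (N + 1)) k :=
  Matrix.reindex finSumFinEquiv finSumFinEquiv
    (Matrix.fromBlocks B 0 0 (1 : Matrix (Fin 1) (Fin 1) k))

theorem det_extendMatrix (B : Matrix (Fin N) (Fin N) k) : (extendMatrix B).det = B.det := by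
  rw [extendMatrix, Matrix.det_reindex_self, Matrix.det_fromBlocks_zero₂₁]
  simp

theorem dehom_substGL_extendMatrix (B : Matrix (Fin N) (Fin N) k)
    (G : MvPolynomial (Fin (N + 1)) k) :
    dehom (substGL (extendMatrix B) G) = substGL B (dehom G) := by
  have hc : ∀ i : Fin N, finSumFinEquiv.symm i.castSucc = (Sum.inl i : Fin N ⊕ Fin 1) :=
    fun i => finSumFinEquiv_symm_apply_castAdd i
  have hl : finSumFinEquiv.symm (Fin.last N) = (Sum.inr 0 : Fin N ⊕ Fin 1) :=
    finSumFinEquiv_symm_last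
  unfold dehom substGL
  rw [← AlgHom.comp_apply, ← AlgHom.comp_apply]
  congr 1
  refine MvPolynomial.algHom_ext fun i => ?_
  refine Fin.lastCases ?_ (fun i => ?_) i <;>
  simp [extendMatrix, Fin.sum_univ_castSucc, hc, hl, algHom_C]

end Dehomogenization

section Order

variable {k : Type*} [CommSemiring k] {n : ℕ}

theorem le_ord0 {f : MvPolynomial (Fin n) k} (hf : f ≠ 0) {e : ℕ}
    (h : ∀ m ∈ f.support, e ≤ ∑ i, m i) : e ≤ ord0 f := by
  rw [ord0, dif_pos (support_nonempty.mpr hf)]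
  exact Finset.le_inf' _ _ h

theorem adeg_neg_iff {α : Fin n → ℤ} {G : MvPolynomial (Fin n) k} (hG : G ≠ 0) :
    adeg α G < 0 ↔ ∀ m ∈ G.support, ∑ i, (m i : ℤ) * α i < 0 := by
  rw [adeg, dif_pos (support_nonempty.mpr hG), Finset.sup'_lt_iff]

theorem homogeneousComponent_eq_C_mul_X_pow {f : MvPolynomial (Fin n) k} {e : ℕ} {j : Fin n}
    (h : ∀ m ∈ f.support, ∑ i, m i = e → ∀ i, i ≠ j → m i = 0) :
    homogeneousComponent e f = C (coeff (Finsupp.single j e) f) * X j ^ e := by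
  classical
  ext m
  rw [coeff_homogeneousComponent, X_pow_eq_monomial, C_mul_monomial, mul_one, coeff_monomial]
  by_cases hm : Finsupp.single j e = m
  · subst hm
    simp
  · rw [if_neg hm]
    split_ifs with hdeg
    · by_contra hne
      rw [Finsupp.degree_eq_sum] at hdeg
      have h0 := h m (mem_support_iff.mpr hne) hdeg
      apply hm
      ext i
      by_cases hij : i = j
      · subst hij
        rw [Finsupp.single_eq_same, ← hdeg]
        exact Finset.sum_eq_single i (fun b _ hb => h0 b hb) (by simp)
      · rw [h0 i hij, Finsupp.single_eq_of_ne hij]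
    · rfl

end Order

theorem exists_vecMul_eq_single {k : Type*} [Field k] {n : ℕ} {l : Fin n → k} (hl : l ≠ 0)
    (i : Fin n) : ∃ B : Matrix (Fin n) (Fin n) k, IsUnit B.det ∧
      Matrix.vecMul l B = Pi.single i 1 := by
  obtain ⟨j, hj⟩ := Function.ne_iff.mp hl
  set M : Matrix (Fin n) (Fin n) k := Matrix.updateRow 1 j l with hM
  have hdet : M.det = l j := by
    rw [hM, ← Matrix.cramer_transpose_apply]
    simp
  have hu : IsUnit M.det := by
    rw [hdet]
    exact isUnit_iff_ne_zero.mpr hj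
  have hrow : Matrix.vecMul (Pi.single j 1) M = l := by
    rw [Matrix.single_one_vecMul]
    exact Matrix.updateRow_self
  refine ⟨M⁻¹ * (Equiv.swap i j).permMatrix k, ?_, ?_⟩
  · rw [Matrix.det_mul, Matrix.det_permutation]
    refine (Matrix.isUnit_nonsing_inv_det M hu).mul ?_
    exact ((Equiv.Perm.sign (Equiv.swap i j)).isUnit.map (Int.castRingHom k))
  · rw [← Matrix.vecMul_vecMul]
    conv_lhs => rw [← hrow]
    rw [Matrix.vecMul_vecMul (Pi.single j 1), Matrix.mul_nonsing_inv _ hu, Matrix.vecMul_one,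
      Matrix.vecMul_permMatrix]
    funext x
    simp only [Function.comp, Pi.single_apply, Equiv.symm_swap]
    congr 1
    rw [Equiv.swap_apply_eq_iff, Equiv.swap_apply_right]

theorem substGL_linear {k : Type*} [CommRing k] {n : ℕ} (B : Matrix (Fin n) (Fin n) k)
    (l : Fin n → k) : substGL B (∑ i, C (l i) * X i) = ∑ j, C (Matrix.vecMul l B j) * X j := by
  simp only [substGL, map_sum, map_mul, algHom_C, aeval_X, algebraMap_eq, Finset.mul_sum,
    Matrix.vecMul, dotProduct, Finset.sum_mul]
  rw [Finset.sum_comm]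
  simp only [mul_assoc]

theorem homogeneousComponent_one_eq_sum {k : Type*} [CommSemiring k] {n : ℕ}
    (f : MvPolynomial (Fin n) k) :
    homogeneousComponent 1 f = ∑ i, C (coeff (Finsupp.single i 1) f) * X i := by
  classical
  ext m
  rw [coeff_homogeneousComponent, coeff_sum]
  simp only [coeff_C_mul, coeff_X]
  split_ifs with h
  · obtain ⟨i, rfl⟩ := (Finsupp.sum_eq_one_iff m).mp h
    simp [Finsupp.single_left_inj]
  · symm
    refine Finset.sum_eq_zero fun i _ => ?_
    rw [if_neg, mul_zero]
    rintro rfl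
    simp at h

/-- A linear tangent form can be moved to a multiple of any prescribed coordinate. -/
theorem exists_homogeneousComponent_one_eq {k : Type*} [Field k] {N : ℕ}
    (G : MvPolynomial (Fin (N + 1)) k) (j : Fin N) :
    ∃ A : Matrix.GeneralLinearGroup (Fin (N + 1)) k,
      (∃ B, dehom (substGL (↑A) G) = substGL B (dehom G)) ∧
      ∃ c, homogeneousComponent 1 (dehom (substGL (↑A) G)) = C c * X j := by
  classical
  set l : Fin N → k := fun i => coeff (Finsupp.single i 1) (dehom G) with hl
  by_cases h0 : l = 0
  · refine ⟨1, ⟨1, by simp [substGL_one]⟩, 0, ?_⟩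
    rw [Units.val_one, substGL_one, homogeneousComponent_one_eq_sum]
    have : ∀ i, coeff (Finsupp.single i 1) (dehom G) = 0 := fun i => congrFun h0 i
    simp [this]
  · obtain ⟨B, hB, hlB⟩ := exists_vecMul_eq_single h0 j
    refine ⟨Matrix.GeneralLinearGroup.mk'' (extendMatrix B) (by rwa [det_extendMatrix]),
      ⟨B, dehom_substGL_extendMatrix B G⟩, 1, ?_⟩
    change homogeneousComponent 1 (dehom (substGL (extendMatrix B) G)) = _
    rw [dehom_substGL_extendMatrix, homogeneousComponent_substGL,
      homogeneousComponent_one_eq_sum, substGL_linear B l, hlB]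
    simp [Pi.single_apply]

/-- A destabilizing weight can be arranged, after permuting the coordinates, to be monotone. -/
theorem exists_monotone_of_adeg_neg {k : Type*} [Field k] {n : ℕ} {F : MvPolynomial (Fin n) k}
    (hF0 : F ≠ 0) (g : Matrix.GeneralLinearGroup (Fin n) k) {α : Fin n → ℤ}
    (h : adeg α (substGL (↑g) F) < 0) :
    ∃ (g' : Matrix.GeneralLinearGroup (Fin n) k) (σ : Equiv.Perm (Fin n)), Monotone (α ∘ σ) ∧
      adeg (α ∘ σ) (substGL (↑g') F) < 0 := by
  classical
  set σ := Tuple.sort α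
  have hu : IsUnit ((σ⁻¹).permMatrix k).det := by
    rw [Matrix.det_permutation]
    exact ((Equiv.Perm.sign σ⁻¹).isUnit.map (Int.castRingHom k))
  refine ⟨g * Matrix.GeneralLinearGroup.mk'' _ hu, σ, Tuple.monotone_sort α, ?_⟩
  rw [adeg_neg_iff (substGL_ne_zero _ hF0)] at h ⊢
  intro m hm
  have heq : substGL (↑(g * Matrix.GeneralLinearGroup.mk'' _ hu)) F =
      rename (σ⁻¹ : Equiv.Perm (Fin n)) (substGL (↑g) F) := by
    rw [← substGL_permMatrix, substGL_substGL]
    rfl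
  rw [heq, support_rename_of_injective (σ⁻¹).injective, Finset.mem_image] at hm
  obtain ⟨M, hM, rfl⟩ := hm
  refine lt_of_eq_of_lt ?_ (h M hM)
  rw [← Equiv.sum_comp σ fun i => (M i : ℤ) * α i]
  refine Finset.sum_congr rfl fun i _ => ?_
  have : (Finsupp.mapDomain (σ⁻¹ : Equiv.Perm (Fin n)) M) i = M (σ i) := by
    conv_lhs => rw [← Equiv.symm_apply_apply σ i]
    exact Finsupp.mapDomain_apply (σ⁻¹).injective M (σ i)
  rw [this]
  rfl

/-- Assume `N ≥ 2`. If the multiplicity of `H = {F = 0}` at every point is at most `δ`,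
at every point of multiplicity exactly `δ` the lowest-degree homogeneous part of the
local equation is not a scalar multiple of `x_0^δ` (i.e. the support of the projective
tangent cone is not a projective hyperplane), and `d ≥ (N+1)·(δ-1)`, then `F` satisfies
the Hilbert–Mumford criterion for semistability, i.e. `H` is semistable. -/
theorem semistable_of_tangentCone_support_not_hyperplane {k : Type*} [Field k]
    [IsAlgClosed k] {N d : ℕ} (hN : 2 ≤ N) (hd : 2 ≤ d)
    (F : MvPolynomial (Fin (N+1)) k) (hF0 : F ≠ 0) (hFhom : F.IsHomogeneous d)
    (δ : ℕ) (hδ : 1 ≤ δ)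
    (hmult : ∀ h : Matrix.GeneralLinearGroup (Fin (N+1)) k,
      ord0 (dehom (substGL (↑h) F)) ≤ δ)
    (hplane : ∀ h : Matrix.GeneralLinearGroup (Fin (N+1)) k,
      ord0 (dehom (substGL (↑h) F)) = δ → ∀ c : k,
        MvPolynomial.homogeneousComponent δ (dehom (substGL (↑h) F))
          ≠ MvPolynomial.C c * (MvPolynomial.X (⟨0, by omega⟩ : Fin N)) ^ δ)
    (hdeg : ((N : ℤ) + 1) * ((δ : ℤ) - 1) ≤ (d : ℤ)) :
    ∀ g : Matrix.GeneralLinearGroup (Fin (N+1)) k, ∀ α : Fin (N+1) → ℤ,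
      α ≠ 0 → (∑ i, α i) = 0 → 0 ≤ adeg α (substGL (↑g) F) := by
  intro g₀ α₀ _ hsum₀
  by_contra! hneg₀
  obtain ⟨g, σ, hmono, hneg⟩ := exists_monotone_of_adeg_neg hF0 g₀ hneg₀
  set α := α₀ ∘ σ with hα
  have hsum : ∑ i, α i = 0 := by rw [← hsum₀]; exact Equiv.sum_comp σ α₀
  clear_value α
  set G := substGL (↑g) F with hGdef
  have hG0 : G ≠ 0 := substGL_ne_zero g hF0
  have hGhom : G.IsHomogeneous d := hFhom.substGL _
  rw [adeg_neg_iff hG0] at hneg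
  set j : Fin N := ⟨0, by omega⟩
  set β : Fin N → ℤ := fun i => α (Fin.last N) - α i.castSucc with hβ
  have hβ0 : ∀ i, 0 ≤ β i := fun i => sub_nonneg.mpr (hmono (Fin.le_last _))
  have hβj : ∀ i, β i ≤ β j := fun i =>
    sub_le_sub_left (hmono (Fin.mk_le_mk.mpr (Nat.zero_le _))) _
  have hβsum : ∑ i, β i = (N + 1) * α (Fin.last N) := by
    rw [Fin.sum_univ_castSucc] at hsum
    simp only [hβ, Finset.sum_sub_distrib, Finset.sum_const, Finset.card_univ, Fintype.card_fin,
      nsmul_eq_mul]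
    linarith
  have hβnn : 0 ≤ ∑ i, β i := Finset.sum_nonneg fun i _ => hβ0 i
  have hlast : 0 ≤ α (Fin.last N) := by
    by_contra! hlt
    have : (0 : ℤ) < N + 1 := by positivity
    nlinarith
  have hweight : ∀ m ∈ (dehom G).support,
      (d : ℤ) * α (Fin.last N) < ∑ i, (m i : ℤ) * β i := by
    intro m hm
    obtain ⟨M, hM, rfl⟩ := exists_mem_support_of_mem_support_dehom hm
    have h1 := hneg M hM
    have h2 : (∑ i, (M i : ℤ)) = d := mod_cast hGhom.sum_eq_of_mem_support hM
    rw [Fin.sum_univ_castSucc] at h1 h2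
    simp only [hβ, initExponent_apply, mul_sub, Finset.sum_sub_distrib, ← Finset.sum_mul]
    rw [← h2]
    linarith
  have hstrict : ∀ m ∈ (dehom G).support,
      ((δ : ℤ) - 1) * ∑ i, β i < ∑ i, (m i : ℤ) * β i := by
    intro m hm
    refine lt_of_le_of_lt ?_ (hweight m hm)
    rw [hβsum]
    nlinarith
  have hjle : β j ≤ ∑ i, β i :=
    Finset.single_le_sum (fun i _ => hβ0 i) (Finset.mem_univ j)
  have hδle : ∀ m ∈ (dehom G).support, δ ≤ ∑ i, m i := by
    intro m hm
    by_contra! hlt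
    have h1 := hstrict m hm
    have h2 : ∑ i, (m i : ℤ) * β i ≤ (∑ i, (m i : ℤ)) * β j := by
      rw [Finset.sum_mul]
      exact Finset.sum_le_sum fun i _ => mul_le_mul_of_nonneg_left (hβj i) (by positivity)
    have h3 : (∑ i, (m i : ℤ)) ≤ δ - 1 := by
      have : ((∑ i, m i : ℕ) : ℤ) < δ := by exact_mod_cast hlt
      push_cast at this
      linarith
    have h4 : (0 : ℤ) ≤ δ - 1 := by
      have : (1 : ℤ) ≤ δ := by exact_mod_cast hδ
      linarith
    nlinarith [hβ0 j]
  rcases hδ.eq_or_lt with rfl | hδ2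
  · obtain ⟨A, ⟨B, hAB⟩, c, hc⟩ := exists_homogeneousComponent_one_eq G j
    have hGA : substGL (↑A) G = substGL (↑(g * A)) F := by
      rw [hGdef, substGL_substGL]
      rfl
    have hne : dehom (substGL (↑A) G) ≠ 0 :=
      dehom_ne_zero (hGhom.substGL _) (substGL_ne_zero A hG0)
    have hconst : homogeneousComponent 0 (dehom G) = 0 := by
      rw [homogeneousComponent_zero, C_eq_zero]
      by_contra h
      have := hδle 0 (mem_support_iff.mpr h)
      simp at this
    have hord : 1 ≤ ord0 (dehom (substGL (↑A) G)) := by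
      refine le_ord0 hne fun m hm => ?_
      by_contra! hlt
      have hm0 : m = 0 := by
        rw [← Finsupp.degree_eq_zero_iff, Finsupp.degree_eq_sum]
        omega
      subst hm0
      have h0 := homogeneousComponent_substGL B (dehom G) 0
      rw [hconst, ← hAB, homogeneousComponent_zero] at h0
      have h0' : C (coeff 0 (dehom (substGL (↑A) G))) = (0 : MvPolynomial (Fin N) k) := by
        rw [h0]
        simp [substGL]
      exact mem_support_iff.mp hm (C_eq_zero.mp h0')
    rw [hGA] at hord hc
    exact hplane (g * A) (le_antisymm (hmult _) hord) c (by rw [hc, pow_one])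
  · have hord : δ ≤ ord0 (dehom G) := le_ord0 (dehom_ne_zero hGhom hG0) hδle
    refine hplane g (le_antisymm (hmult g) hord) _
      (homogeneousComponent_eq_C_mul_X_pow fun m hm hmδ i hij => ?_)
    by_contra hmi
    have h1 := hstrict m hm
    have hmδ' : (∑ i, (m i : ℤ)) = δ := by exact_mod_cast hmδ
    have hmi1 : (1 : ℤ) ≤ m i := by exact_mod_cast Nat.one_le_iff_ne_zero.mpr hmi
    have h2 : ∑ x, (m x : ℤ) * β x ≤ δ * β j - (β j - β i) := by
      have h3 : (m i : ℤ) * (β j - β i) ≤ ∑ x, (m x : ℤ) * (β j - β x) :=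
        Finset.single_le_sum (f := fun x => (m x : ℤ) * (β j - β x))
          (fun x _ => mul_nonneg (by positivity) (sub_nonneg.mpr (hβj x))) (Finset.mem_univ i)
      simp only [mul_sub, Finset.sum_sub_distrib, ← Finset.sum_mul] at h3
      rw [hmδ'] at h3
      nlinarith [hβj i]
    have h4 : β j + β i ≤ ∑ x, β x := by
      rw [← Finset.sum_pair hij.symm]
      exact Finset.sum_le_sum_of_subset_of_nonneg (Finset.subset_univ _) fun x _ _ => hβ0 x
    have h5 : (2 : ℤ) ≤ δ := by exact_mod_cast hδ2
    nlinarith [hβ0 i, mul_le_mul_of_nonneg_left h4 (by linarith : (0 : ℤ) ≤ δ - 1)]
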